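/- arXiv:2110.08045 — 5 statements merged into one kernel-verified Lean document; each statement's English description precedes it below -/
import Mathlib

section
/- Let 𝔖 denote the ICA model set of 4th-order tensors over ℝ^n and let 𝔑(𝔖−𝔖) = { (Z₁−Z₂)/‖Z₁−Z₂‖_F : Z₁, Z₂ ∈ 𝔖, Z₁ ≠ Z₂ } be its normalized secant set. Then there exists a constant C₅ > 0 such that for every ε ∈ (0,1), the covering number of 𝔑(𝔖−𝔖) with respect to the Frobenius norm satisfies CN(𝔑(𝔖−𝔖), ‖·‖_F, ε) ≤ (C₅/ε)^{2n(n+1)}; that is, there exists a finite subset of 𝔑(𝔖−𝔖) of cardinality at most (C₅/ε)^{2n(n+1)} such that every element of 𝔑(𝔖−𝔖) is within Frobenius distance ε of some element of this subset. -/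
open scoped BigOperators
open MeasureTheory ProbabilityTheory Matrix
open scoped NNReal ENNReal

noncomputable section

/-- 4th-order tensors over ℝⁿ. -/
abbrev T4 (n : ℕ) := Fin n → Fin n → Fin n → Fin n → ℝ

/-- Squared Frobenius norm of a 4th-order tensor. -/
def frobSq {n : ℕ} (S : T4 n) : ℝ := ∑ i, ∑ j, ∑ k, ∑ l, (S i j k l) ^ 2

/-- Frobenius norm of a 4th-order tensor. -/
def frob {n : ℕ} (S : T4 n) : ℝ := Real.sqrt (frobSq S)

/-- Vectorization of a 4th-order tensor. -/
def tvec {n : ℕ} (S : T4 n) : Fin n × Fin n × Fin n × Fin n → ℝ :=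
  fun x => S x.1 x.2.1 x.2.2.1 x.2.2.2

/-- Squared Euclidean norm. -/
def l2Sq {ι : Type*} [Fintype ι] (v : ι → ℝ) : ℝ := ∑ i, (v i) ^ 2

/-- Euclidean norm. -/
def l2 {ι : Type*} [Fintype ι] (v : ι → ℝ) : ℝ := Real.sqrt (l2Sq v)

/-- Multilinear transform of a 4th-order tensor by four matrices. -/
def mulT {n : ℕ} (S : T4 n) (A B C D : Matrix (Fin n) (Fin n) ℝ) : T4 n :=
  fun i j k l => ∑ p, ∑ q, ∑ r, ∑ s, A i p * B j q * C k r * D l s * S p q r s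

/-- Diagonal 4th-order tensors with diagonal entries at least `εS`. -/
def IsDiagT {n : ℕ} (εS : ℝ) (S : T4 n) : Prop :=
  (∀ i j k l, ¬ (j = i ∧ k = i ∧ l = i) → S i j k l = 0) ∧ ∀ i, εS ≤ S i i i i

/-- The ICA model set. -/
def ICAset (n : ℕ) (εS : ℝ) : Set (T4 n) :=
  { Z | ∃ S Q, IsDiagT εS S ∧ Qᵀ * Q = 1 ∧ Z = mulT S Q Q Q Q }

/-- The i.i.d.-Gaussian-entries (mean 0, variance 1/m) measure on m×p matrices,
with p indexed by 4-tuples. -/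
def gaussMat (m n : ℕ) :
    Measure (Fin m → (Fin n × Fin n × Fin n × Fin n) → ℝ) :=
  Measure.pi fun _ : Fin m =>
    Measure.pi fun _ : Fin n × Fin n × Fin n × Fin n =>
      gaussianReal 0 ((m : ℝ≥0))⁻¹

/-- The restricted isometry property with constant δ on the ICA model set. -/
def RIPset (n m : ℕ) (εS δ : ℝ) :
    Set (Fin m → (Fin n × Fin n × Fin n × Fin n) → ℝ) :=
  { A | ∀ Z₁ ∈ ICAset n εS, ∀ Z₂ ∈ ICAset n εS,
      (1 - δ) * frobSq (Z₁ - Z₂) ≤ l2Sq ((Matrix.of A).mulVec (tvec (Z₁ - Z₂))) ∧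
      l2Sq ((Matrix.of A).mulVec (tvec (Z₁ - Z₂))) ≤ (1 + δ) * frobSq (Z₁ - Z₂) }

end
/-- The normalized secant set of the ICA model set. -/
def normSecant (n : ℕ) (εS : ℝ) : Set (T4 n) :=
  { Y | ∃ Z₁ ∈ ICAset n εS, ∃ Z₂ ∈ ICAset n εS, Z₁ ≠ Z₂ ∧
      Y = (frob (Z₁ - Z₂))⁻¹ • (Z₁ - Z₂) }

/-- The tensor `∑ p, a p • (Q p)^{⊗4}` built from the columns of `Q`. -/
noncomputable def quarticSum {n : ℕ} (a : Fin n → ℝ) (Q : Matrix (Fin n) (Fin n) ℝ) : T4 n :=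
  fun i j k l => ∑ p, a p * (Q i p * Q j p * Q k p * Q l p)

theorem mulT_eq_quarticSum {n : ℕ} {εS : ℝ} {S : T4 n} (hS : IsDiagT εS S)
    (Q : Matrix (Fin n) (Fin n) ℝ) :
    mulT S Q Q Q Q = quarticSum (fun p => S p p p p) Q := by
  funext i j k l
  simp only [mulT, quarticSum]
  refine Finset.sum_congr rfl fun p _ => ?_
  rw [Finset.sum_eq_single p, Finset.sum_eq_single p, Finset.sum_eq_single p]
  · ring
  · intro s _ h
    rw [hS.1 p p p s (by tauto), mul_zero]
  · simp
  · intro r _ h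
    exact Finset.sum_eq_zero fun s _ => by rw [hS.1 p p r s (by tauto), mul_zero]
  · simp
  · intro q _ h
    exact Finset.sum_eq_zero fun r _ => Finset.sum_eq_zero fun s _ => by
      rw [hS.1 p q r s (by tauto), mul_zero]
  · simp

theorem sum_mul_eq_ite {n : ℕ} {Q : Matrix (Fin n) (Fin n) ℝ} (hQ : Qᵀ * Q = 1) (p q : Fin n) :
    ∑ i, Q i p * Q i q = if p = q then 1 else 0 := by
  have := congrFun (congrFun hQ p) q
  simpa [Matrix.mul_apply, Matrix.one_apply] using this

theorem abs_apply_le_one {n : ℕ} {Q : Matrix (Fin n) (Fin n) ℝ} (hQ : Qᵀ * Q = 1)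
    (i p : Fin n) : |Q i p| ≤ 1 := by
  have h := sum_mul_eq_ite hQ p p
  rw [if_pos rfl] at h
  have h2 := Finset.single_le_sum (f := fun i => Q i p * Q i p)
    (fun i _ => mul_self_nonneg _) (Finset.mem_univ i)
  rw [abs_le]
  constructor <;> nlinarith

/-- Some permutation picks out only entries of absolute value at least `1 / n!`. -/
theorem exists_perm_inv_factorial_le {n : ℕ} {O : Matrix (Fin n) (Fin n) ℝ}
    (hO : ∀ i j, |O i j| ≤ 1) (hdet : |O.det| = 1) :
    ∃ σ : Equiv.Perm (Fin n), ∀ p, ((n.factorial : ℝ))⁻¹ ≤ |O (σ p) p| := by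
  by_contra! hcon
  have hlt : ∀ σ : Equiv.Perm (Fin n), ∏ p, |O (σ p) p| < ((n.factorial : ℝ))⁻¹ := by
    intro σ
    obtain ⟨p, hp⟩ := hcon σ
    refine lt_of_le_of_lt ?_ hp
    rw [← Finset.mul_prod_erase _ _ (Finset.mem_univ p)]
    exact mul_le_of_le_one_right (abs_nonneg _)
      (Finset.prod_le_one (fun _ _ => abs_nonneg _) fun _ _ => hO _ _)
  have h1 : |O.det| ≤ ∑ σ : Equiv.Perm (Fin n), ∏ p, |O (σ p) p| := by
    rw [Matrix.det_apply']
    refine (Finset.abs_sum_le_sum_abs _ _).trans (Finset.sum_le_sum fun σ _ => ?_)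
    rw [abs_mul, Finset.abs_prod]
    rcases Int.units_eq_one_or (Equiv.Perm.sign σ) with h | h <;> simp [h]
  have h2 : ∑ σ : Equiv.Perm (Fin n), ∏ p, |O (σ p) p|
      < ∑ _σ : Equiv.Perm (Fin n), ((n.factorial : ℝ))⁻¹ :=
    Finset.sum_lt_sum_of_nonempty Finset.univ_nonempty fun σ _ => hlt σ
  have h3 : (n.factorial : ℝ) ≠ 0 := by exact_mod_cast n.factorial_ne_zero
  simp [Fintype.card_perm, h3] at h2
  linarith

theorem abs_sum_mul_le_one {n : ℕ} {Q R : Matrix (Fin n) (Fin n) ℝ} (hQ : Qᵀ * Q = 1)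
    (hR : Rᵀ * R = 1) (p q : Fin n) : |∑ i, Q i p * R i q| ≤ 1 := by
  have h := abs_apply_le_one (Q := Qᵀ * R) (by
    rw [Matrix.transpose_mul, Matrix.transpose_transpose, Matrix.mul_assoc,
      ← Matrix.mul_assoc Q, mul_eq_one_comm.mp hQ, Matrix.one_mul, hR]) p q
  simpa [Matrix.mul_apply] using h

/-- Permuting columns and flipping their signs, one orthogonal frame can be aligned with another
without changing the set of tensors `quarticSum b R`. -/
theorem exists_aligned_frame {n : ℕ} {Q R : Matrix (Fin n) (Fin n) ℝ} (hQ : Qᵀ * Q = 1)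
    (hR : Rᵀ * R = 1) (b : Fin n → ℝ) :
    ∃ (R' : Matrix (Fin n) (Fin n) ℝ) (b' : Fin n → ℝ), R'ᵀ * R' = 1 ∧
      quarticSum b' R' = quarticSum b R ∧
      ∀ p, ((n.factorial : ℝ))⁻¹ ≤ ∑ i, Q i p * R' i p := by
  have hdet : |(Qᵀ * R).det| = 1 := by
    have hq := congrArg Matrix.det hQ
    have hr := congrArg Matrix.det hR
    rw [Matrix.det_mul, Matrix.det_transpose, Matrix.det_one] at hq hr
    rw [Matrix.det_mul, Matrix.det_transpose, ← abs_one, ← sq_eq_sq_iff_abs_eq_abs]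
    linear_combination R.det * R.det * hq + hr
  obtain ⟨σ, hσ⟩ := exists_perm_inv_factorial_le
    (fun i j => by simpa [Matrix.mul_apply] using abs_sum_mul_le_one hQ hR i j) hdet
  set O := Qᵀ * R with hO
  set s : Fin n → ℝ := fun p => if 0 ≤ O p (σ.symm p) then 1 else -1 with hs
  have hss : ∀ p, s p * s p = 1 := fun p => by simp only [hs]; split_ifs <;> norm_num
  refine ⟨Matrix.of fun i p => s p * R i (σ.symm p), fun p => b (σ.symm p), ?_, ?_, ?_⟩
  · ext p q
    simp only [Matrix.mul_apply, Matrix.transpose_apply, Matrix.one_apply, Matrix.of_apply]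
    have h : ∑ i, s p * R i (σ.symm p) * (s q * R i (σ.symm q))
        = s p * s q * ∑ i, R i (σ.symm p) * R i (σ.symm q) := by
      rw [Finset.mul_sum]; exact Finset.sum_congr rfl fun _ _ => by ring
    rw [h, sum_mul_eq_ite hR]
    by_cases hpq : p = q
    · subst hpq; simp [hss]
    · simp [hpq]
  · funext i j k l
    simp only [quarticSum, Matrix.of_apply]
    rw [← Equiv.sum_comp σ.symm (fun p => b p * (R i p * R j p * R k p * R l p))]
    refine Finset.sum_congr rfl fun p _ => ?_
    linear_combination (b (σ.symm p) * R i (σ.symm p) * R j (σ.symm p) * R k (σ.symm p)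
      * R l (σ.symm p)) * (s p * s p + 1) * hss p
  · intro p
    have h := hσ (σ.symm p)
    rw [Equiv.apply_symm_apply] at h
    have h2 : ∑ i, Q i p * (s p * R i (σ.symm p)) = s p * O p (σ.symm p) := by
      rw [hO, Matrix.mul_apply, Finset.mul_sum]
      exact Finset.sum_congr rfl fun _ _ => by rw [Matrix.transpose_apply]; ring
    simp only [Matrix.of_apply]
    rw [h2]
    refine h.trans_eq ?_
    simp only [hs]
    split_ifs with h0
    · rw [abs_of_nonneg h0, one_mul]
    · rw [abs_of_neg (not_le.mp h0)]; ring

theorem contraction_quarticSum {n : ℕ} {Q : Matrix (Fin n) (Fin n) ℝ} (hQ : Qᵀ * Q = 1)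
    (a x : Fin n → ℝ) (p k l : Fin n) :
    ∑ i, ∑ j, Q i p * x j * quarticSum a Q i j k l
      = a p * (∑ j, x j * Q j p) * (Q k p * Q l p) := by
  have h : ∀ i j, Q i p * x j * quarticSum a Q i j k l
      = ∑ q, a q * (Q k q * Q l q) * ((Q i p * Q i q) * (x j * Q j q)) := by
    intro i j
    rw [quarticSum, Finset.mul_sum]
    exact Finset.sum_congr rfl fun _ _ => by ring
  simp only [h]
  have h2 : ∀ i, ∑ j, ∑ q, a q * (Q k q * Q l q) * ((Q i p * Q i q) * (x j * Q j q))
      = ∑ q, a q * (Q k q * Q l q) * ((Q i p * Q i q) * ∑ j, x j * Q j q) := by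
    intro i
    rw [Finset.sum_comm]
    simp only [Finset.mul_sum]
  simp only [h2]
  rw [Finset.sum_comm]
  simp only [← Finset.mul_sum, ← Finset.sum_mul, sum_mul_eq_ite hQ]
  simp
  ring

theorem contraction_quarticSum_snd {n : ℕ} {Q : Matrix (Fin n) (Fin n) ℝ} (hQ : Qᵀ * Q = 1)
    (a x : Fin n → ℝ) (p k l : Fin n) :
    ∑ i, ∑ j, x i * Q j p * quarticSum a Q i j k l
      = a p * (∑ j, x j * Q j p) * (Q k p * Q l p) := by
  rw [← contraction_quarticSum hQ, Finset.sum_comm]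
  refine Finset.sum_congr rfl fun i _ => Finset.sum_congr rfl fun j _ => ?_
  have : quarticSum a Q j i k l = quarticSum a Q i j k l :=
    Finset.sum_congr rfl fun _ _ => by ring
  rw [this]; ring

/-- If the difference of two orthogonally decomposable tensors has bounded entries, then so do the
differences of the aligned rank-one matrices. -/
theorem abs_rankOne_sub_le {n : ℕ} {Q R : Matrix (Fin n) (Fin n) ℝ} (hQ : Qᵀ * Q = 1)
    (hR : Rᵀ * R = 1) {a b : Fin n → ℝ} {c₀ : ℝ} (hc₀ : 0 < c₀)
    (hY : ∀ i j k l, |quarticSum a Q i j k l - quarticSum b R i j k l| ≤ 1) {p : Fin n}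
    (hp : c₀ ≤ ∑ i, Q i p * R i p) (k l : Fin n) :
    |a p * (Q k p * Q l p) - b p * (R k p * R l p)| ≤ (n : ℝ) ^ 2 / c₀ := by
  have h1 : ∑ i, ∑ j, Q i p * R j p * (quarticSum a Q i j k l - quarticSum b R i j k l)
      = (∑ i, Q i p * R i p) * (a p * (Q k p * Q l p) - b p * (R k p * R l p)) := by
    simp only [mul_sub, Finset.sum_sub_distrib]
    rw [contraction_quarticSum hQ a (fun j => R j p),
      contraction_quarticSum_snd hR b (fun i => Q i p)]
    simp only [mul_comm (R _ p) (Q _ p)]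
    ring
  have h2 : |∑ i, ∑ j, Q i p * R j p * (quarticSum a Q i j k l - quarticSum b R i j k l)|
      ≤ ∑ _i : Fin n, ∑ _j : Fin n, (1 : ℝ) := by
    refine (Finset.abs_sum_le_sum_abs _ _).trans (Finset.sum_le_sum fun i _ => ?_)
    refine (Finset.abs_sum_le_sum_abs _ _).trans (Finset.sum_le_sum fun j _ => ?_)
    rw [abs_mul, abs_mul]
    exact mul_le_one₀ (mul_le_one₀ (abs_apply_le_one hQ i p) (abs_nonneg _)
      (abs_apply_le_one hR j p)) (abs_nonneg _) (hY i j k l)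
  rw [h1, abs_mul, abs_of_pos (hc₀.trans_le hp)] at h2
  simp only [Finset.sum_const, Finset.card_univ, Fintype.card_fin, nsmul_eq_mul, mul_one] at h2
  rw [le_div_iff₀ hc₀]
  nlinarith [abs_nonneg (a p * (Q k p * Q l p) - b p * (R k p * R l p))]

/-- For unit vectors `u`, `v` at an acute angle, a bound on `a u uᵀ - b v vᵀ` bounds
`a - b` and `b (v - u)`. -/
theorem abs_sub_le_and_abs_mul_sub_le {n : ℕ} {u v : Fin n → ℝ} (hu : ∑ i, u i * u i = 1)
    (hv : ∑ i, v i * v i = 1) (hu1 : ∀ i, |u i| ≤ 1) (hv1 : ∀ i, |v i| ≤ 1)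
    (hc : 0 ≤ ∑ i, u i * v i) (hc1 : ∑ i, u i * v i ≤ 1) {a b K : ℝ}
    (hM : ∀ k l, |a * (u k * u l) - b * (v k * v l)| ≤ K) :
    |a - b| ≤ n * K ∧ ∀ k, |b * (v k - u k)| ≤ 3 * (n * K) + n * (n * K) := by
  have htr : |a - b| ≤ n * K := by
    have h1 : ∑ k, (a * (u k * u k) - b * (v k * v k)) = a - b := by
      rw [Finset.sum_sub_distrib, ← Finset.mul_sum, ← Finset.mul_sum, hu, hv]; ring
    rw [← h1]
    refine (Finset.abs_sum_le_sum_abs _ _).trans ((Finset.sum_le_sum fun k _ => hM k k).trans ?_)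
    simp
  set c := ∑ i, u i * v i with hcdef
  have hvec : ∀ k, |a * c * u k - b * v k| ≤ n * K := by
    intro k
    have h1 : ∑ l, v l * (a * (u k * u l) - b * (v k * v l)) = a * c * u k - b * v k := by
      have : ∀ l, v l * (a * (u k * u l) - b * (v k * v l))
          = a * u k * (u l * v l) - b * v k * (v l * v l) := fun l => by ring
      simp only [this]
      rw [Finset.sum_sub_distrib, ← Finset.mul_sum, ← Finset.mul_sum, hv, ← hcdef]; ring
    rw [← h1]
    refine (Finset.abs_sum_le_sum_abs _ _).trans
      ((Finset.sum_le_sum (g := fun _ => K) fun l _ => ?_).trans (by simp))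
    rw [abs_mul]
    exact (mul_le_of_le_one_left (abs_nonneg _) (hv1 l)).trans (hM k l)
  have hscal : |a * c ^ 2 - b| ≤ n * (n * K) := by
    have h1 : ∑ k, v k * (a * c * u k - b * v k) = a * c ^ 2 - b := by
      have : ∀ k, v k * (a * c * u k - b * v k)
          = a * c * (u k * v k) - b * (v k * v k) := fun l => by ring
      simp only [this]
      rw [Finset.sum_sub_distrib, ← Finset.mul_sum, ← Finset.mul_sum, hv, ← hcdef]; ring
    rw [← h1]
    refine (Finset.abs_sum_le_sum_abs _ _).trans
      ((Finset.sum_le_sum (g := fun _ => n * K) fun k _ => ?_).trans (by simp))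
    rw [abs_mul]
    exact (mul_le_of_le_one_left (abs_nonneg _) (hv1 k)).trans (hvec k)
  refine ⟨htr, fun k => ?_⟩
  have hgap : |b * (1 - c)| ≤ n * K + n * (n * K) := by
    calc |b * (1 - c)| ≤ |b * (1 - c)| * (1 + c) :=
          le_mul_of_one_le_right (abs_nonneg _) (by linarith)
      _ = |(a - b) * c ^ 2 - (a * c ^ 2 - b)| := by
          rw [show (a - b) * c ^ 2 - (a * c ^ 2 - b) = b * (1 - c) * (1 + c) by ring,
            abs_mul (b * (1 - c)), abs_of_nonneg (show 0 ≤ 1 + c by linarith)]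
      _ ≤ |(a - b) * c ^ 2| + |a * c ^ 2 - b| := abs_sub _ _
      _ ≤ n * K + n * (n * K) := by
          refine add_le_add ?_ hscal
          rw [abs_mul, abs_of_nonneg (sq_nonneg c)]
          exact (mul_le_of_le_one_right (abs_nonneg _) (pow_le_one₀ hc hc1)).trans htr
  have h1 : b * (v k - u k)
      = (a - b) * (c * u k) - (a * c * u k - b * v k) - b * (1 - c) * u k := by ring
  have h2 : |(a - b) * (c * u k)| ≤ n * K := by
    rw [abs_mul, abs_mul, abs_of_nonneg hc]
    exact (mul_le_of_le_one_right (abs_nonneg _)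
      (mul_le_one₀ hc1 (abs_nonneg _) (hu1 k))).trans htr
  have h3 : |b * (1 - c) * u k| ≤ n * K + n * (n * K) := by
    rw [abs_mul]
    exact (mul_le_of_le_one_right (abs_nonneg _) (hu1 k)).trans hgap
  rw [h1]
  have h4 := hvec k
  rw [abs_le] at *
  constructor <;> linarith [h2.1, h2.2, h3.1, h3.2, h4.1, h4.2]

/-- A vector is a multiple of one whose entries are bounded by `1` and attain `1`. -/
theorem exists_normalized_direction {n : ℕ} (hn : 0 < n) (d : Fin n → ℝ) :
    ∃ (k : Fin n) (w : Fin n → ℝ), w k = 1 ∧ (∀ i, |w i| ≤ 1) ∧ ∀ i, d i = d k * w i := by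
  have : Nonempty (Fin n) := ⟨⟨0, hn⟩⟩
  obtain ⟨k, -, hk⟩ := Finset.exists_max_image Finset.univ (fun i => |d i|) Finset.univ_nonempty
  by_cases h0 : d k = 0
  · refine ⟨k, fun i => if i = k then 1 else 0, if_pos rfl, fun i => ?_, fun i => ?_⟩
    · dsimp only; split_ifs <;> simp
    · have := hk i (Finset.mem_univ i)
      rw [h0, abs_zero] at this
      rw [h0, zero_mul, abs_nonpos_iff.mp this]
  · refine ⟨k, fun i => d i / d k, div_self h0, fun i => ?_, fun i => ?_⟩
    · rw [abs_div]
      exact div_le_one_of_le₀ (hk i (Finset.mem_univ i)) (abs_nonneg _)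
    · field_simp

theorem abs_apply_le_frob {n : ℕ} (Z : T4 n) (i j k l : Fin n) : |Z i j k l| ≤ frob Z := by
  refine Real.abs_le_sqrt ?_
  have h1 : ∀ i j k, 0 ≤ ∑ l, Z i j k l ^ 2 := fun i j k => Finset.sum_nonneg fun _ _ => sq_nonneg _
  have h2 : ∀ i j, 0 ≤ ∑ k, ∑ l, Z i j k l ^ 2 := fun i j => Finset.sum_nonneg fun k _ => h1 i j k
  have h3 : ∀ i, 0 ≤ ∑ j, ∑ k, ∑ l, Z i j k l ^ 2 := fun i => Finset.sum_nonneg fun j _ => h2 i j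
  calc Z i j k l ^ 2 ≤ ∑ l, Z i j k l ^ 2 :=
        Finset.single_le_sum (f := fun l => Z i j k l ^ 2) (fun _ _ => sq_nonneg _)
          (Finset.mem_univ l)
    _ ≤ ∑ k, ∑ l, Z i j k l ^ 2 :=
        Finset.single_le_sum (f := fun k => ∑ l, Z i j k l ^ 2) (fun k _ => h1 i j k)
          (Finset.mem_univ k)
    _ ≤ ∑ j, ∑ k, ∑ l, Z i j k l ^ 2 :=
        Finset.single_le_sum (f := fun j => ∑ k, ∑ l, Z i j k l ^ 2) (fun j _ => h2 i j)
          (Finset.mem_univ j)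
    _ ≤ frobSq Z :=
        Finset.single_le_sum (f := fun i => ∑ j, ∑ k, ∑ l, Z i j k l ^ 2) (fun i _ => h3 i)
          (Finset.mem_univ i)

theorem frob_le_sq_mul_norm {n : ℕ} (Z : T4 n) : frob Z ≤ (n : ℝ) ^ 2 * ‖Z‖ := by
  refine Real.sqrt_le_iff.mpr ⟨by positivity, ?_⟩
  have h : ∀ i j k l, Z i j k l ^ 2 ≤ ‖Z‖ ^ 2 := fun i j k l => by
    rw [← sq_abs]
    refine pow_le_pow_left₀ (abs_nonneg _) ?_ 2
    rw [← Real.norm_eq_abs]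
    exact (norm_le_pi_norm _ l).trans <| (norm_le_pi_norm _ k).trans <|
      (norm_le_pi_norm _ j).trans (norm_le_pi_norm Z i)
  calc frobSq Z ≤ ∑ _i : Fin n, ∑ _j : Fin n, ∑ _k : Fin n, ∑ _l : Fin n, ‖Z‖ ^ 2 :=
        Finset.sum_le_sum fun i _ => Finset.sum_le_sum fun j _ => Finset.sum_le_sum fun k _ =>
          Finset.sum_le_sum fun l _ => h i j k l
    _ = ((n : ℝ) ^ 2 * ‖Z‖) ^ 2 := by simp; ring

/-- Index set of the real parameters describing a tensor in the normalized secant set. -/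
abbrev SecantIndex (n : ℕ) := Fin n × (Fin n ⊕ Fin n ⊕ Fin 2)

/-- The direction `w` of the `p`-th difference of frame vectors: its `κ p`-th entry is `1`, so the
corresponding parameter is free to store its length. -/
noncomputable def secantDir {n : ℕ} (κ : Fin n → Fin n) (x : SecantIndex n → ℝ) (p i : Fin n) : ℝ :=
  if i = κ p then 1 else x (p, Sum.inl i)

/-- The vector `v = u + h w`. -/
noncomputable def secantEnd {n : ℕ} (κ : Fin n → Fin n) (x : SecantIndex n → ℝ) (p i : Fin n) : ℝ :=
  x (p, Sum.inr (Sum.inl i)) + x (p, Sum.inl (κ p)) * secantDir κ x p i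

/-- A polynomial parametrization: for `v = u + h w`, `c = b h` and `s = a - b` the `p`-th term
equals `a u^{⊗4} - b v^{⊗4}`. -/
noncomputable def secantParam {n : ℕ} (κ : Fin n → Fin n) (x : SecantIndex n → ℝ) : T4 n :=
  fun i j k l => ∑ p,
    let u := fun i => x (p, Sum.inr (Sum.inl i))
    let w := secantDir κ x p
    let v := secantEnd κ x p
    x (p, Sum.inr (Sum.inr 1)) * (u i * u j * u k * u l) -
      x (p, Sum.inr (Sum.inr 0)) * (w i * u j * u k * u l + v i * w j * u k * u l +
        v i * v j * w k * u l + v i * v j * v k * w l)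

theorem contDiff_secantParam {n : ℕ} (κ : Fin n → Fin n) :
    ContDiff ℝ 1 (secantParam κ) := by
  have hw : ∀ p i, ContDiff ℝ 1 fun x => secantDir κ x p i := fun p i => by
    unfold secantDir
    split_ifs <;> fun_prop
  have hv : ∀ p i, ContDiff ℝ 1 fun x => secantEnd κ x p i := fun p i => by
    unfold secantEnd
    have := hw p i
    fun_prop
  refine contDiff_pi.mpr fun i => contDiff_pi.mpr fun j => contDiff_pi.mpr fun k =>
    contDiff_pi.mpr fun l => ?_
  unfold secantParam
  dsimp only
  refine ContDiff.sum fun p _ => ?_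
  have := hw p
  have := hv p
  fun_prop

theorem exists_secantParam_eq {n : ℕ} {Q R : Matrix (Fin n) (Fin n) ℝ} (hQ : Qᵀ * Q = 1)
    (hR : Rᵀ * R = 1) {a b : Fin n → ℝ} {c₀ K : ℝ} (hc₀ : 0 < c₀)
    (hK : K = n * ((n : ℝ) ^ 2 / c₀))
    (hY : ∀ i j k l, |quarticSum a Q i j k l - quarticSum b R i j k l| ≤ 1)
    (halign : ∀ p, c₀ ≤ ∑ i, Q i p * R i p) :
    ∃ (κ : Fin n → Fin n) (x : SecantIndex n → ℝ), (∀ e, |x e| ≤ 2 + (3 * K + n * K)) ∧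
      secantParam κ x = quarticSum a Q - quarticSum b R := by
  have hK0 : 0 ≤ K := hK ▸ by positivity
  have hnK : 0 ≤ n * K := by positivity
  have hbd : ∀ p, |a p - b p| ≤ K ∧ ∀ k, |b p * (R k p - Q k p)| ≤ 3 * K + n * K := by
    intro p
    rw [hK]
    exact abs_sub_le_and_abs_mul_sub_le (by simpa using sum_mul_eq_ite hQ p p)
      (by simpa using sum_mul_eq_ite hR p p) (fun i => abs_apply_le_one hQ i p)
      (fun i => abs_apply_le_one hR i p) (hc₀.le.trans (halign p))
      ((le_abs_self _).trans (abs_sum_mul_le_one hQ hR p p))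
      (fun k l => abs_rankOne_sub_le hQ hR hc₀ hY (halign p) k l)
  choose κ w hwκ hw1 hd using fun p : Fin n =>
    exists_normalized_direction p.pos fun i => R i p - Q i p
  let x : SecantIndex n → ℝ := fun e => Sum.elim
    (fun i => if i = κ e.1 then R (κ e.1) e.1 - Q (κ e.1) e.1 else w e.1 i)
    (Sum.elim (fun i => Q i e.1)
      ![b e.1 * (R (κ e.1) e.1 - Q (κ e.1) e.1), a e.1 - b e.1]) e.2
  have hdir : ∀ p i, secantDir κ x p i = w p i := by
    intro p i
    by_cases h : i = κ p
    · simp [secantDir, h, hwκ]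
    · simp [secantDir, h, x]
  have hend : ∀ p i, secantEnd κ x p i = R i p := by
    intro p i
    have := hd p i
    simp only [secantEnd, hdir, x, Sum.elim_inl, Sum.elim_inr, if_true]
    linarith
  refine ⟨κ, x, ?_, ?_⟩
  · rintro ⟨p, i | i | i⟩
    · simp only [x, Sum.elim_inl]
      split_ifs
      · have h1 := abs_apply_le_one hQ (κ p) p
        have h2 := abs_apply_le_one hR (κ p) p
        have h3 := abs_sub (R (κ p) p) (Q (κ p) p)
        linarith
      · have := hw1 p i
        linarith
    · have := abs_apply_le_one hQ i p
      simp only [x, Sum.elim_inl, Sum.elim_inr]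
      linarith
    · have h1 := (hbd p).1
      have h2 := (hbd p).2 (κ p)
      fin_cases i
      · change |b p * (R (κ p) p - Q (κ p) p)| ≤ _
        linarith
      · change |a p - b p| ≤ _
        linarith
  · funext i j k l
    simp only [Pi.sub_apply, quarticSum, secantParam, hdir, hend, ← Finset.sum_sub_distrib]
    refine Finset.sum_congr rfl fun p _ => ?_
    have hx1 : x (p, Sum.inr (Sum.inr 1)) = a p - b p := rfl
    have hx0 : x (p, Sum.inr (Sum.inr 0)) = b p * (R (κ p) p - Q (κ p) p) := rfl
    have hxu : ∀ i, x (p, Sum.inr (Sum.inl i)) = Q i p := fun _ => rfl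
    simp only [hx1, hx0, hxu]
    have hv : ∀ i, R i p = Q i p + (R (κ p) p - Q (κ p) p) * w p i := fun i => by
      have := hd p i
      linarith
    generalize R (κ p) p - Q (κ p) p = h at hv
    rw [hv i, hv j, hv k, hv l]
    ring

/-- The normalized secant set is covered by finitely many polynomial images of a box. -/
theorem exists_box_secantParam (n : ℕ) (εS : ℝ) :
    ∃ B : ℝ, 0 < B ∧ ∀ Y ∈ normSecant n εS, ∃ (κ : Fin n → Fin n) (x : SecantIndex n → ℝ),
      (∀ e, |x e| ≤ B) ∧ secantParam κ x = Y := by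
  have hfac : (0 : ℝ) < ((n.factorial : ℝ))⁻¹ := by positivity
  set K : ℝ := n * ((n : ℝ) ^ 2 / ((n.factorial : ℝ))⁻¹) with hK
  refine ⟨2 + (3 * K + n * K), by positivity, ?_⟩
  rintro Y ⟨Z₁, ⟨S, Q, hS, hQ, rfl⟩, Z₂, ⟨T, R, hT, hR, rfl⟩, -, rfl⟩
  rw [mulT_eq_quarticSum hS, mulT_eq_quarticSum hT]
  set Z := quarticSum (fun p => S p p p p) Q - quarticSum (fun p => T p p p p) R with hZ
  set t := (frob Z)⁻¹ with ht
  have ht0 : 0 ≤ t := inv_nonneg.mpr (Real.sqrt_nonneg _)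
  have hsmul : ∀ (a : Fin n → ℝ) (P : Matrix (Fin n) (Fin n) ℝ),
      quarticSum (t • a) P = t • quarticSum a P := fun a P => by
    funext i j k l
    simp [quarticSum, Finset.mul_sum, mul_assoc]
  obtain ⟨R', b', hR', hb', halign⟩ :=
    exists_aligned_frame hQ hR (t • fun p => T p p p p)
  have hY : t • Z = quarticSum (t • fun p => S p p p p) Q - quarticSum b' R' := by
    rw [hb', hsmul, hsmul, hZ, smul_sub]
  rw [hY]
  refine exists_secantParam_eq hQ hR' hfac hK (fun i j k l => ?_) halign
  have h1 : (t • Z) i j k l = quarticSum (t • fun p => S p p p p) Q i j k l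
      - quarticSum b' R' i j k l := by rw [hY]; rfl
  rw [← h1]
  calc |(t • Z) i j k l| = t * |Z i j k l| := by
        rw [← abs_of_nonneg ht0, ← abs_mul, abs_of_nonneg ht0]; rfl
    _ ≤ t * frob Z := mul_le_mul_of_nonneg_left (abs_apply_le_frob Z i j k l) ht0
    _ ≤ 1 := inv_mul_le_one

/-- An internal net for a set covered by finitely many Lipschitz images of a box: round the
parameters to a grid and keep one point of the set for each occurring grid cell. -/
theorem exists_finset_net {ι κ E : Type*} [Fintype ι] [Fintype κ] {N : Set E} {B : ℝ}
    (f : κ → (ι → ℝ) → E) (hN : ∀ y ∈ N, ∃ k x, (∀ e, |x e| ≤ B) ∧ f k x = y) {δ : ℝ}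
    (hδ : 0 < δ) (P : E → E → Prop)
    (hP : ∀ k x x', (∀ e, |x e| ≤ B) → (∀ e, |x' e| ≤ B) → (∀ e, |x e - x' e| ≤ δ) →
      P (f k x) (f k x')) :
    ∃ F : Finset E, (↑F : Set E) ⊆ N ∧
      F.card ≤ Fintype.card κ * (2 * ⌈B / δ⌉₊ + 1) ^ Fintype.card ι ∧
      ∀ y ∈ N, ∃ z ∈ F, P y z := by
  classical
  rcases N.eq_empty_or_nonempty with rfl | ⟨y₀, hy₀⟩
  · exact ⟨∅, by simp⟩
  have : Nonempty E := ⟨y₀⟩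
  have : Nonempty κ := ⟨(hN y₀ hy₀).choose⟩
  choose! k x hx hf using hN
  set M : ℤ := (⌈B / δ⌉₊ : ℤ) with hM
  let g : E → κ × (ι → ℤ) := fun y => (k y, fun e => ⌊x y e / δ⌋)
  let G : Finset (κ × (ι → ℤ)) :=
    Finset.univ ×ˢ Fintype.piFinset fun _ : ι => Finset.Icc (-M) M
  have hg : ∀ y ∈ N, g y ∈ G := by
    intro y hy
    simp only [G, g, Finset.mem_product, Finset.mem_univ, true_and, Fintype.mem_piFinset,
      Finset.mem_Icc]
    intro e
    have h1 : |x y e / δ| ≤ (M : ℝ) := by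
      rw [abs_div, abs_of_pos hδ, hM]
      exact (div_le_div_of_nonneg_right (hx y hy e) hδ.le).trans (by exact_mod_cast Nat.le_ceil _)
    rw [abs_le] at h1
    refine ⟨Int.le_floor.mpr (by push_cast; exact h1.1), ?_⟩
    exact_mod_cast (Int.floor_le _).trans h1.2
  have hfin : (g '' N).Finite := G.finite_toSet.subset (Set.image_subset_iff.mpr hg)
  obtain ⟨F, hFN, hFg, hFcard⟩ : ∃ F : Finset E, (↑F : Set E) ⊆ N ∧
      (∀ c ∈ g '' N, ∃ z ∈ F, g z = c) ∧ F.card ≤ G.card := by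
    choose! r hrN hrg using fun c (hc : c ∈ g '' N) => hc
    refine ⟨hfin.toFinset.image r, ?_, ?_, ?_⟩
    · intro z hz
      simp only [Finset.coe_image, Set.Finite.coe_toFinset] at hz
      obtain ⟨c, hc, rfl⟩ := hz
      exact hrN c hc
    · exact fun c hc => ⟨r c, Finset.mem_image_of_mem r (hfin.mem_toFinset.mpr hc), hrg c hc⟩
    · refine Finset.card_image_le.trans (Finset.card_le_card fun c hc => ?_)
      obtain ⟨y, hy, rfl⟩ := hfin.mem_toFinset.mp hc
      exact hg y hy
  refine ⟨F, hFN, hFcard.trans_eq ?_, fun y hy => ?_⟩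
  · rw [Finset.card_product, Fintype.card_piFinset, Finset.prod_const,
      Finset.card_univ, Int.card_Icc, Finset.card_univ]
    congr 2
    omega
  · obtain ⟨z, hzF, hz⟩ := hFg _ (Set.mem_image_of_mem g hy)
    refine ⟨z, hzF, ?_⟩
    have hzN := hFN hzF
    have hk : k z = k y := congrArg Prod.fst hz
    rw [← hf y hy, ← hf z hzN, hk]
    refine hP _ _ _ (hx y hy) (hx z hzN) fun e => ?_
    have h1 := Int.abs_sub_lt_one_of_floor_eq_floor (congrFun (congrArg Prod.snd hz) e)
    rw [← sub_div, abs_div, abs_of_pos hδ, div_lt_one hδ] at h1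
    rw [abs_sub_comm]
    exact h1.le

theorem exists_lipschitzOnWith_secantParam (n : ℕ) (B : ℝ) :
    ∃ L : ℝ≥0, ∀ κ : Fin n → Fin n,
      LipschitzOnWith L (secantParam κ) (Metric.closedBall 0 B) := by
  choose L hL using fun κ : Fin n → Fin n =>
    (contDiff_secantParam κ).contDiffOn.exists_lipschitzOnWith one_ne_zero
      (convex_closedBall (0 : SecantIndex n → ℝ) B) (isCompact_closedBall 0 B)
  exact ⟨∑ κ, L κ, fun κ => (hL κ).weaken
    (Finset.single_le_sum (fun _ _ => zero_le) (Finset.mem_univ κ))⟩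

/-- Covering number of the normalized secant set, Lemma 2.
There is a constant C₅ > 0 such that for every ε ∈ (0,1) the normalized secant
set of the ICA model set admits an internal ε-net of cardinality at most
(C₅/ε)^(2n(n+1)) in the Frobenius norm. -/
theorem covering_normalized_secant (n : ℕ) (εS : ℝ) (hεS : 0 < εS) :
    ∃ C₅ > (0 : ℝ), ∀ ε ∈ Set.Ioo (0 : ℝ) 1,
      ∃ F : Finset (T4 n),
        (↑F : Set (T4 n)) ⊆ normSecant n εS ∧
        (F.card : ℝ) ≤ (C₅ / ε) ^ (2 * n * (n + 1)) ∧
        ∀ x ∈ normSecant n εS, ∃ y ∈ F, frob (x - y) ≤ ε := by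
  obtain ⟨B, hB, hbox⟩ := exists_box_secantParam n εS
  obtain ⟨L, hL⟩ := exists_lipschitzOnWith_secantParam n B
  set D : ℝ := (n : ℝ) ^ 2 * L + 1 with hD
  have hD0 : 0 < D := by positivity
  refine ⟨(n + 1) * (2 * (B * D) + 3), by positivity, fun ε ⟨hε0, hε1⟩ => ?_⟩
  obtain ⟨F, hFN, hFcard, hFnet⟩ := exists_finset_net secantParam hbox (div_pos hε0 hD0)
    (fun x y => frob (x - y) ≤ ε) fun κ x x' hx hx' hxx' => by
      have hmem : ∀ z : SecantIndex n → ℝ, (∀ e, |z e| ≤ B) → z ∈ Metric.closedBall 0 B :=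
        fun z hz => mem_closedBall_zero_iff.mpr ((pi_norm_le_iff_of_nonneg hB.le).mpr hz)
      have h1 := (hL κ).dist_le_mul x (hmem x hx) x' (hmem x' hx')
      have h2 : dist x x' ≤ ε / D :=
        (dist_pi_le_iff (by positivity)).mpr fun e => by rw [Real.dist_eq]; exact hxx' e
      rw [dist_eq_norm] at h1
      calc frob (secantParam κ x - secantParam κ x')
          ≤ (n : ℝ) ^ 2 * ‖secantParam κ x - secantParam κ x'‖ := frob_le_sq_mul_norm _
        _ ≤ (n : ℝ) ^ 2 * (L * (ε / D)) := by gcongr; exact h1.trans (by gcongr)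
        _ ≤ D * (ε / D) := by
            rw [← mul_assoc]
            gcongr
            linarith
        _ = ε := by field_simp
  refine ⟨F, hFN, ?_, hFnet⟩
  have hdim : Fintype.card (SecantIndex n) = 2 * n * (n + 1) := by
    simp only [SecantIndex, Fintype.card_prod, Fintype.card_sum, Fintype.card_fin]
    ring
  rw [hdim, Fintype.card_fun, Fintype.card_fin] at hFcard
  have hpow : (n : ℝ) ^ n ≤ ((n : ℝ) + 1) ^ (2 * n * (n + 1)) :=
    calc (n : ℝ) ^ n ≤ ((n : ℝ) + 1) ^ n := by gcongr; linarith
      _ ≤ ((n : ℝ) + 1) ^ (2 * n * (n + 1)) :=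
          pow_le_pow_right₀ (by linarith [n.cast_nonneg (α := ℝ)]) (by nlinarith)
  have hgrid : (2 * (⌈B / (ε / D)⌉₊ : ℝ) + 1) ≤ (2 * (B * D) + 3) / ε := by
    have h1 := (Nat.ceil_lt_add_one (show 0 ≤ B / (ε / D) by positivity)).le
    have h2 : B / (ε / D) = B * D / ε := by field_simp
    rw [h2] at h1 ⊢
    calc (2 * (⌈B * D / ε⌉₊ : ℝ) + 1) ≤ 2 * (B * D / ε) + 3 * 1 := by linarith
      _ ≤ 2 * (B * D / ε) + 3 * (1 / ε) := by
          gcongr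
          exact (one_le_div hε0).mpr hε1.le
      _ = (2 * (B * D) + 3) / ε := by ring
  calc (F.card : ℝ) ≤ (n : ℝ) ^ n * (2 * (⌈B / (ε / D)⌉₊ : ℝ) + 1) ^ (2 * n * (n + 1)) := by
        exact_mod_cast hFcard
    _ ≤ ((n : ℝ) + 1) ^ (2 * n * (n + 1)) * ((2 * (B * D) + 3) / ε) ^ (2 * n * (n + 1)) := by
        gcongr
    _ = ((n + 1) * (2 * (B * D) + 3) / ε) ^ (2 * n * (n + 1)) := by
        rw [← mul_pow, mul_div_assoc]
end

section
/- Let 𝔖̄̄ = 𝔖 ∩ {Z : ‖Z‖_F = 1} denote the ICA model set intersected with the Frobenius unit sphere of ℝ^{n×n×n×n}. Then for every ε ∈ (0,1), the covering number of 𝔖̄̄ with respect to the Frobenius norm satisfies CN(𝔖̄̄, ‖·‖_F, ε) ≤ (6/ε)^{n(n+1)}. -/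
open scoped BigOperators
open MeasureTheory ProbabilityTheory Matrix
open scoped NNReal ENNReal

/-- The ICA model set intersected with the Frobenius unit sphere. -/
def ICAsphere (n : ℕ) (εS : ℝ) : Set (T4 n) :=
  { Z ∈ ICAset n εS | frob Z = 1 }

open Metric Module in
/-- Volume bound for the cardinality of a separated subset of the unit ball. -/
theorem card_le_of_separated_unit_ball {E : Type*} [NormedAddCommGroup E] [NormedSpace ℝ E]
    [FiniteDimensional ℝ E] {δ : ℝ} (hδ : 0 < δ) (s : Finset E) (hs : ∀ c ∈ s, ‖c‖ ≤ 1)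
    (h : ∀ c ∈ s, ∀ d ∈ s, c ≠ d → δ ≤ ‖c - d‖) :
    (s.card : ℝ) ≤ (1 + 2 / δ) ^ finrank ℝ E := by
  borelize E
  let μ : Measure E := Measure.addHaar
  have hρ : 0 < 1 + δ / 2 := by positivity
  have hdisj : Set.Pairwise (s : Set E) (Function.onFun Disjoint fun c => ball (c : E) (δ / 2)) := by
    rintro c hc d hd hcd
    apply ball_disjoint_ball
    rw [dist_eq_norm]
    linarith [h c hc d hd hcd]
  have hsub : ⋃ c ∈ s, ball (c : E) (δ / 2) ⊆ ball (0 : E) (1 + δ / 2) := by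
    refine Set.iUnion₂_subset fun x hx => ball_subset_ball' ?_
    rw [dist_zero_right]
    linarith [hs x hx]
  have hvol : (s.card : ℝ≥0∞) * ENNReal.ofReal ((δ / 2) ^ finrank ℝ E) * μ (ball 0 1) ≤
      ENNReal.ofReal ((1 + δ / 2) ^ finrank ℝ E) * μ (ball 0 1) := by
    have := measure_mono (μ := μ) hsub
    rw [measure_biUnion_finset hdisj fun c _ => measurableSet_ball] at this
    simpa only [μ.addHaar_ball_of_pos _ (half_pos hδ), μ.addHaar_ball_of_pos _ hρ,
      Finset.sum_const, nsmul_eq_mul, mul_assoc] using this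
  have hcard : (s.card : ℝ≥0∞) * ENNReal.ofReal ((δ / 2) ^ finrank ℝ E) ≤
      ENNReal.ofReal ((1 + δ / 2) ^ finrank ℝ E) :=
    (ENNReal.mul_le_mul_iff_left (measure_ball_pos _ _ zero_lt_one).ne' measure_ball_lt_top.ne).1
      hvol
  have hreal := ENNReal.toReal_le_of_le_ofReal (pow_nonneg hρ.le _) hcard
  rw [ENNReal.toReal_mul, ENNReal.toReal_natCast, ENNReal.toReal_ofReal (by positivity)] at hreal
  have heq : 1 + 2 / δ = (1 + δ / 2) / (δ / 2) := by field_simp; ring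
  rw [heq, div_pow, le_div_iff₀ (by positivity)]
  exact hreal

open Metric Module in
/-- Every subset of the unit ball has an internal `δ`-net of cardinality at most
`(1 + 2 / δ) ^ d`. -/
theorem exists_internal_net {E : Type*} [NormedAddCommGroup E] [NormedSpace ℝ E]
    [FiniteDimensional ℝ E] {δ : ℝ} (hδ : 0 < δ) (A : Set E) (hA : ∀ x ∈ A, ‖x‖ ≤ 1) :
    ∃ C : Finset E, (C : Set E) ⊆ A ∧ (C.card : ℝ) ≤ (1 + 2 / δ) ^ finrank ℝ E ∧
      ∀ x ∈ A, ∃ y ∈ C, ‖x - y‖ ≤ δ := by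
  classical
  let P : ℕ → Prop := fun k => ∃ C : Finset E, (C : Set E) ⊆ A ∧
    (∀ c ∈ C, ∀ d ∈ C, c ≠ d → δ ≤ ‖c - d‖) ∧ C.card = k
  have hbound : ∀ C : Finset E, (C : Set E) ⊆ A →
      (∀ c ∈ C, ∀ d ∈ C, c ≠ d → δ ≤ ‖c - d‖) → (C.card : ℝ) ≤ (1 + 2 / δ) ^ finrank ℝ E :=
    fun C hC hsep => card_le_of_separated_unit_ball hδ C (fun c hc => hA c (hC hc)) hsep
  have hP0 : P 0 := ⟨∅, by simp, by simp, rfl⟩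
  obtain ⟨C, hC, hsep, hcard⟩ : P (Nat.findGreatest P ⌊(1 + 2 / δ) ^ finrank ℝ E⌋₊) :=
    Nat.findGreatest_spec (Nat.zero_le _) hP0
  refine ⟨C, hC, hbound C hC hsep, fun x hx => ?_⟩
  by_contra! hfar
  have hxC : x ∉ C := fun hmem => by simpa [hδ.not_gt] using hfar x hmem
  have hC' : ((insert x C : Finset E) : Set E) ⊆ A := by
    rw [Finset.coe_insert]
    exact Set.insert_subset hx hC
  have hsep' : ∀ c ∈ insert x C, ∀ d ∈ insert x C, c ≠ d → δ ≤ ‖c - d‖ := by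
    intro c hc d hd hcd
    rcases Finset.mem_insert.1 hc with rfl | hcC <;>
      rcases Finset.mem_insert.1 hd with rfl | hdC
    · exact absurd rfl hcd
    · exact (hfar d hdC).le
    · rw [norm_sub_rev]
      exact (hfar c hcC).le
    · exact hsep c hcC d hdC hcd
  have hle := Nat.le_findGreatest (P := P) (Nat.le_floor (hbound _ hC' hsep')) ⟨_, hC', hsep', rfl⟩
  rw [Finset.card_insert_of_notMem hxC, hcard] at hle
  omega

/-- The space of parameters of the ICA model: the weights sit at `none`, the columns of the mixing
matrix at the remaining indices. -/
abbrev ICAParam (n : ℕ) := Option (Fin n) → EuclideanSpace ℝ (Fin n)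

/-- The tensor `∑ₚ sₚ qₚ ⊗ qₚ ⊗ qₚ ⊗ qₚ` with weights `s = x none` and columns
`qₚ = x (some p)`. -/
def paramTensor {n : ℕ} (x : ICAParam n) : T4 n := fun i j k l =>
  ∑ p, x none p * (x (some p) i * x (some p) j * x (some p) k * x (some p) l)

/-- Parameters of the elements of `ICAsphere n εS`. -/
def ICASphereParam (n : ℕ) (εS : ℝ) : Set (ICAParam n) :=
  {x | ‖x none‖ = 1 ∧ (∀ i, εS ≤ x none i) ∧ Orthonormal ℝ fun p => x (some p)}

theorem sum_paramTensor_mul {n : ℕ} (x y : ICAParam n) :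
    ∑ i, ∑ j, ∑ k, ∑ l, paramTensor x i j k l * paramTensor y i j k l =
      ∑ p, ∑ q, x none p * y none q * inner ℝ (x (some p)) (y (some q)) ^ 4 := by
  have hpow : ∀ a : Fin n → ℝ, (∑ i, a i) ^ 4 =
      ∑ z : Fin n × Fin n × Fin n × Fin n, a z.1 * a z.2.1 * a z.2.2.1 * a z.2.2.2 := by
    intro a
    simp only [Fintype.sum_prod_type, ← Finset.mul_sum, ← Finset.sum_mul]
    ring
  have hprod : ∑ i, ∑ j, ∑ k, ∑ l, paramTensor x i j k l * paramTensor y i j k l =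
      ∑ z : Fin n × Fin n × Fin n × Fin n, paramTensor x z.1 z.2.1 z.2.2.1 z.2.2.2 *
        paramTensor y z.1 z.2.1 z.2.2.1 z.2.2.2 := by
    simp only [Fintype.sum_prod_type]
  rw [hprod]
  simp only [paramTensor, Finset.sum_mul_sum]
  rw [Finset.sum_comm]
  refine Finset.sum_congr rfl fun p _ => ?_
  rw [Finset.sum_comm]
  refine Finset.sum_congr rfl fun q _ => ?_
  rw [PiLp.inner_apply, hpow, Finset.mul_sum]
  refine Finset.sum_congr rfl fun z _ => ?_
  simp only [RCLike.inner_apply, conj_trivial]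
  ring

theorem frobSq_paramTensor {n : ℕ} {x : ICAParam n}
    (hx : Orthonormal ℝ fun p => x (some p)) :
    frobSq (paramTensor x) = ‖x none‖ ^ 2 := by
  have h := sum_paramTensor_mul x x
  simp only [← sq] at h
  rw [frobSq, h, EuclideanSpace.real_norm_sq_eq]
  refine Finset.sum_congr rfl fun p _ => ?_
  rw [Finset.sum_eq_single p]
  · rw [real_inner_self_eq_norm_sq, hx.1 p]
    ring
  · intro q _ hq
    rw [hx.2 hq.symm]
    simp
  · simp

theorem frobSq_sub {n : ℕ} (S T : T4 n) :
    frobSq (S - T) = frobSq S + frobSq T - 2 * ∑ i, ∑ j, ∑ k, ∑ l, S i j k l * T i j k l := by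
  simp only [frobSq, Pi.sub_apply, Finset.mul_sum, ← Finset.sum_add_distrib,
    ← Finset.sum_sub_distrib]
  refine Finset.sum_congr rfl fun i _ => Finset.sum_congr rfl fun j _ =>
    Finset.sum_congr rfl fun k _ => Finset.sum_congr rfl fun l _ => ?_
  ring

theorem one_sub_two_mul_sq_le_inner_pow_four {E : Type*} [NormedAddCommGroup E]
    [InnerProductSpace ℝ E] {u v : E} (hu : ‖u‖ = 1) (hv : ‖v‖ = 1) :
    1 - 2 * ‖u - v‖ ^ 2 ≤ inner ℝ u v ^ 4 := by
  rw [norm_sub_sq_real, hu, hv]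
  generalize (inner ℝ u v : ℝ) = c
  nlinarith [mul_nonneg (sq_nonneg (c - 1)) (add_nonneg (sq_nonneg (c + 1)) zero_le_two)]

theorem frobSq_paramTensor_sub_le {n : ℕ} {εS : ℝ} (hεS : 0 ≤ εS) {x y : ICAParam n}
    (hx : x ∈ ICASphereParam n εS) (hy : y ∈ ICASphereParam n εS) :
    frobSq (paramTensor x - paramTensor y) ≤ 5 * ‖x - y‖ ^ 2 := by
  obtain ⟨hx1, hxε, hxo⟩ := hx
  obtain ⟨hy1, hyε, hyo⟩ := hy
  set d := ‖x - y‖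
  have hd : ∀ o, ‖x o - y o‖ ^ 2 ≤ d ^ 2 := fun o =>
    pow_le_pow_left₀ (norm_nonneg _) (norm_le_pi_norm (x - y) o) 2
  have hnonneg : ∀ p q, 0 ≤ x none p * y none q := fun p q =>
    mul_nonneg (hεS.trans (hxε p)) (hεS.trans (hyε q))
  have hinner : inner ℝ (x none) (y none) = ∑ p, x none p * y none p := by
    simp [PiLp.inner_apply, mul_comm]
  have hlower : inner ℝ (x none) (y none) * (1 - 2 * d ^ 2) ≤
      ∑ p, ∑ q, x none p * y none q * inner ℝ (x (some p)) (y (some q)) ^ 4 := by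
    rw [hinner, Finset.sum_mul]
    refine Finset.sum_le_sum fun p _ => ?_
    refine le_trans ?_ (Finset.single_le_sum (fun q _ =>
      mul_nonneg (hnonneg p q) (by positivity)) (Finset.mem_univ p))
    refine mul_le_mul_of_nonneg_left ?_ (hnonneg p p)
    linarith [one_sub_two_mul_sq_le_inner_pow_four (hxo.1 p) (hyo.1 p), hd (some p)]
  have hle : inner ℝ (x none) (y none) ≤ 1 := by
    simpa [hx1, hy1] using real_inner_le_norm (x none) (y none)
  have hweights := hd none
  rw [norm_sub_sq_real, hx1, hy1] at hweights
  rw [frobSq_sub, sum_paramTensor_mul, frobSq_paramTensor hxo, frobSq_paramTensor hyo, hx1, hy1]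
  nlinarith [mul_le_mul_of_nonneg_right hle (sq_nonneg d)]

theorem mulT_diagonal {n : ℕ} {S : T4 n}
    (hS : ∀ i j k l, ¬ (j = i ∧ k = i ∧ l = i) → S i j k l = 0) (Q : Matrix (Fin n) (Fin n) ℝ)
    (i j k l : Fin n) :
    mulT S Q Q Q Q i j k l = ∑ p, S p p p p * (Q i p * Q j p * Q k p * Q l p) := by
  refine Finset.sum_congr rfl fun p _ => ?_
  rw [Finset.sum_eq_single p, Finset.sum_eq_single p, Finset.sum_eq_single p]
  · ring
  · intro b _ hb
    rw [hS p p p b (by tauto), mul_zero]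
  · simp
  · intro b _ hb
    exact Finset.sum_eq_zero fun c _ => by rw [hS p p b c (by tauto), mul_zero]
  · simp
  · intro b _ hb
    exact Finset.sum_eq_zero fun c _ => Finset.sum_eq_zero fun e _ => by
      rw [hS p b c e (by tauto), mul_zero]
  · simp

theorem orthonormal_columns_iff {n : ℕ} (q : Fin n → EuclideanSpace ℝ (Fin n)) :
    Orthonormal ℝ q ↔ (Matrix.of fun i p => q p i)ᵀ * (Matrix.of fun i p => q p i) = 1 := by
  rw [orthonormal_iff_ite, ← Matrix.ext_iff]
  simp [Matrix.mul_apply, Matrix.one_apply, PiLp.inner_apply, mul_comm]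

theorem paramTensor_mem_ICAsphere {n : ℕ} {εS : ℝ} {x : ICAParam n}
    (hx : x ∈ ICASphereParam n εS) : paramTensor x ∈ ICAsphere n εS := by
  obtain ⟨hx1, hxε, hxo⟩ := hx
  have hdiag : IsDiagT εS fun i j k l => if j = i ∧ k = i ∧ l = i then x none i else 0 :=
    ⟨fun i j k l h => if_neg h, fun i => by simpa using hxε i⟩
  refine ⟨⟨_, _, hdiag, (orthonormal_columns_iff _).1 hxo, ?_⟩, ?_⟩
  · ext i j k l
    rw [mulT_diagonal hdiag.1]
    simp [paramTensor]
  · rw [frob, frobSq_paramTensor hxo, hx1]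
    simp

theorem exists_param_of_mem_ICAsphere {n : ℕ} {εS : ℝ} {Z : T4 n} (hZ : Z ∈ ICAsphere n εS) :
    ∃ x ∈ ICASphereParam n εS, paramTensor x = Z := by
  obtain ⟨⟨S, Q, hS, hQ, rfl⟩, hnorm⟩ := hZ
  let x : ICAParam n := fun o =>
    o.elim (WithLp.toLp 2 fun p => S p p p p) fun p => WithLp.toLp 2 fun i => Q i p
  have hx : paramTensor x = mulT S Q Q Q Q := by
    ext i j k l
    rw [mulT_diagonal hS.1]
    rfl
  have hxo : Orthonormal ℝ fun p => x (some p) := (orthonormal_columns_iff _).2 hQ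
  refine ⟨x, ⟨?_, hS.2, hxo⟩, hx⟩
  rwa [← hx, frob, frobSq_paramTensor hxo, Real.sqrt_sq (norm_nonneg _)] at hnorm

/-- Covering number of the normalized ICA model set, Lemma A.1.
For every ε ∈ (0,1) the ICA model set intersected with the Frobenius unit sphere
admits an internal ε-net of cardinality at most (6/ε)^(n(n+1)). -/
theorem covering_ICA_sphere (n : ℕ) (εS : ℝ) (hεS : 0 < εS) :
    ∀ ε ∈ Set.Ioo (0 : ℝ) 1,
      ∃ F : Finset (T4 n),
        (↑F : Set (T4 n)) ⊆ ICAsphere n εS ∧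
        (F.card : ℝ) ≤ (6 / ε) ^ (n * (n + 1)) ∧
        ∀ x ∈ ICAsphere n εS, ∃ y ∈ F, frob (x - y) ≤ ε := by
  rintro ε ⟨hε0, hε1⟩
  classical
  have hball : ∀ x ∈ ICASphereParam n εS, ‖x‖ ≤ 1 := by
    rintro x ⟨hx1, -, hxo⟩
    refine (pi_norm_le_iff_of_nonneg zero_le_one).2 fun o => ?_
    cases o with
    | none => exact hx1.le
    | some p => exact (hxo.1 p).le
  obtain ⟨C, hC, hcard, hcover⟩ :=
    exists_internal_net (δ := 2 / 5 * ε) (by positivity) (ICASphereParam n εS) hball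
  refine ⟨C.image paramTensor, ?_, ?_, fun Z hZ => ?_⟩
  · intro Z hZ
    obtain ⟨x, hx, rfl⟩ := Finset.mem_image.1 hZ
    exact paramTensor_mem_ICAsphere (hC hx)
  · have hdim : Module.finrank ℝ (ICAParam n) = n * (n + 1) := by
      rw [Module.finrank_pi_fintype]
      simp [mul_comm]
    have hbase : 1 + 2 / (2 / 5 * ε) ≤ 6 / ε := by
      rw [show 2 / (2 / 5 * ε) = 5 / ε by field_simp, le_div_iff₀ hε0, add_mul,
        div_mul_cancel₀ _ hε0.ne']
      linarith
    rw [hdim] at hcard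
    calc ((C.image paramTensor).card : ℝ) ≤ C.card := mod_cast Finset.card_image_le
      _ ≤ _ := hcard
      _ ≤ _ := pow_le_pow_left₀ (by positivity) hbase _
  · obtain ⟨x, hx, rfl⟩ := exists_param_of_mem_ICAsphere hZ
    obtain ⟨y, hy, hxy⟩ := hcover x hx
    refine ⟨_, Finset.mem_image_of_mem _ hy, Real.sqrt_le_iff.2 ⟨hε0.le, ?_⟩⟩
    have hsq := pow_le_pow_left₀ (norm_nonneg _) hxy 2
    nlinarith [frobSq_paramTensor_sub_le hεS.le hx (hC hy)]
end

section
/- Let f(Q, S) = vec(S ×₁Q ×₂Q ×₃Q ×₄Q) viewed as a smooth map of the n² entries of Q ∈ ℝ^{n×n} and the n diagonal entries of the diagonal tensor S. If ‖Q‖₂ ≤ 1 and ‖S‖_F ≤ R, then for all indices i, j, k, ℓ, the second partial derivative with respect to two entries of Q satisfies ‖∂²f/∂Q_{ij}∂Q_{kℓ}‖₂ ≤ 12 R. -/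
open scoped BigOperators
open MeasureTheory ProbabilityTheory Matrix
open scoped NNReal ENNReal

noncomputable section

/-- The diagonal 4th-order tensor with diagonal entries `d`. -/
def diagT {n : ℕ} (d : Fin n → ℝ) : T4 n :=
  fun i j k l => if j = i ∧ k = i ∧ l = i then d i else 0

/-- The parametrization map f(Q,S) = S ×₁Q ×₂Q ×₃Q ×₄Q, viewed as a smooth map on
the n² entries of Q and the n diagonal entries of S. -/
def Fmap {n : ℕ} (u : (Fin n → Fin n → ℝ) × (Fin n → ℝ)) : T4 n :=
  mulT (diagT u.2) (Matrix.of u.1) (Matrix.of u.1) (Matrix.of u.1) (Matrix.of u.1)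

/-- Squared Euclidean norm ‖u‖₂² = ‖Q‖_F² + ‖S‖₂² on the parameter space. -/
def paramNormSq {n : ℕ} (u : (Fin n → Fin n → ℝ) × (Fin n → ℝ)) : ℝ :=
  (∑ i, ∑ j, (u.1 i j) ^ 2) + ∑ i, (u.2 i) ^ 2

/-- Euclidean norm on the parameter space. -/
def paramNorm {n : ℕ} (u : (Fin n → Fin n → ℝ) × (Fin n → ℝ)) : ℝ :=
  Real.sqrt (paramNormSq u)

/-- Membership in Ω = O(n) × 𝔇. -/
def inOmega {n : ℕ} (εS : ℝ) (u : (Fin n → Fin n → ℝ) × (Fin n → ℝ)) : Prop :=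
  (Matrix.of u.1)ᵀ * Matrix.of u.1 = 1 ∧ ∀ i, εS ≤ u.2 i

/-- The coordinate direction corresponding to the matrix entry Q_{ij}. -/
def dirQ {n : ℕ} (i j : Fin n) : (Fin n → Fin n → ℝ) × (Fin n → ℝ) :=
  (fun a b => if a = i ∧ b = j then (1 : ℝ) else 0, 0)

/-- The coordinate direction corresponding to the diagonal entry S_{kkkk}. -/
def dirS {n : ℕ} (k : Fin n) : (Fin n → Fin n → ℝ) × (Fin n → ℝ) :=
  (0, Pi.single k 1)

/-- The spectral (ℓ²-operator) norm of a square real matrix. -/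
def specNorm {n : ℕ} (A : Matrix (Fin n) (Fin n) ℝ) : ℝ :=
  ‖Matrix.toEuclideanCLM (𝕜 := ℝ) A‖

/-- The rank-one tensor `c • x ⊗ y ⊗ z ⊗ w`. -/
def rankOneT {n : ℕ} (c : ℝ) (x y z w : Fin n → ℝ) : T4 n :=
  fun a b r s => c * x a * y b * z r * w s

lemma frob_add_le {n : ℕ} (S T : T4 n) : frob (S + T) ≤ frob S + frob T := by
  have key (U : T4 n) : frob U = ‖WithLp.toLp 2 (tvec U)‖ := by
    simp [frob, frobSq, tvec, EuclideanSpace.norm_eq, Fintype.sum_prod_type]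
  rw [key, key, key]
  exact norm_add_le (WithLp.toLp 2 (tvec S)) (WithLp.toLp 2 (tvec T))

lemma frobSq_rankOneT {n : ℕ} (c : ℝ) (x y z w : Fin n → ℝ) :
    frobSq (rankOneT c x y z w) = c ^ 2 * l2Sq x * l2Sq y * l2Sq z * l2Sq w := by
  simp only [frobSq, rankOneT, l2Sq, mul_pow, ← Finset.mul_sum, ← Finset.sum_mul]

lemma l2Sq_nonneg {ι : Type*} [Fintype ι] (v : ι → ℝ) : 0 ≤ l2Sq v :=
  Finset.sum_nonneg fun _ _ => sq_nonneg _

lemma frob_rankOneT_le {n : ℕ} {c : ℝ} {x y z w : Fin n → ℝ}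
    (hx : l2Sq x ≤ 1) (hy : l2Sq y ≤ 1) (hz : l2Sq z ≤ 1) (hw : l2Sq w ≤ 1) :
    frob (rankOneT c x y z w) ≤ |c| := by
  rw [frob, frobSq_rankOneT]
  refine Real.sqrt_le_iff.2 ⟨abs_nonneg c, ?_⟩
  have hx₀ := l2Sq_nonneg x
  have hy₀ := l2Sq_nonneg y
  have hz₀ := l2Sq_nonneg z
  have hw₀ := l2Sq_nonneg w
  rw [sq_abs]
  calc c ^ 2 * l2Sq x * l2Sq y * l2Sq z * l2Sq w
      ≤ c ^ 2 * 1 * 1 * 1 * 1 := by gcongr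
    _ = c ^ 2 := by ring

lemma Fmap_apply {n : ℕ} (u : (Fin n → Fin n → ℝ) × (Fin n → ℝ)) (a b r s : Fin n) :
    Fmap u a b r s = ∑ p, u.2 p * u.1 a p * u.1 b p * u.1 r p * u.1 s p := by
  simp only [Fmap, mulT, diagT, Matrix.of_apply]
  refine Finset.sum_congr rfl fun p _ => ?_
  simp only [mul_ite, mul_zero, ite_and, Finset.sum_ite_irrel, Finset.sum_const_zero,
    Finset.sum_ite_eq', Finset.mem_univ, if_true]
  ring

lemma fderiv_T4_eq {E : Type*} [NormedAddCommGroup E] [NormedSpace ℝ E] {n : ℕ}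
    {G : E → T4 n} {w v : E} {D : T4 n} (hG : DifferentiableAt ℝ G w)
    (hD : ∀ a b r s, HasDerivAt (fun t : ℝ => G (w + t • v) a b r s) (D a b r s) 0) :
    fderiv ℝ G w v = D := by
  rw [← hG.lineDeriv_eq_fderiv]
  refine HasDerivAt.deriv ?_
  exact hasDerivAt_pi.2 fun a => hasDerivAt_pi.2 fun b => hasDerivAt_pi.2 fun r =>
    hasDerivAt_pi.2 fun s => hD a b r s

lemma hasDerivAt_add_mul (x y : ℝ) : HasDerivAt (fun t : ℝ => x + t * y) y 0 := by
  simpa using ((hasDerivAt_id (0 : ℝ)).mul_const y).const_add x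

lemma differentiable_Fmap {n : ℕ} : Differentiable ℝ (Fmap (n := n)) := by
  refine differentiable_pi.2 fun a => differentiable_pi.2 fun b => differentiable_pi.2 fun r =>
    differentiable_pi.2 fun s => ?_
  simp only [Fmap_apply]
  fun_prop

/-- The sum of the four rank-one tensors in which one factor `q` of `c • q ⊗ q ⊗ q ⊗ q` is
replaced by `x`. -/
def insertOne {n : ℕ} (c : ℝ) (x q : Fin n → ℝ) : T4 n :=
  rankOneT c x q q q + rankOneT c q x q q + rankOneT c q q x q + rankOneT c q q q x

/-- The sum of the twelve rank-one tensors in which two factors `q` of `c • q ⊗ q ⊗ q ⊗ q` are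
replaced by `x` and `y`. -/
def insertTwo {n : ℕ} (c : ℝ) (x y q : Fin n → ℝ) : T4 n :=
  rankOneT c x y q q + rankOneT c x q y q + rankOneT c x q q y +
  rankOneT c y x q q + rankOneT c q x y q + rankOneT c q x q y +
  rankOneT c y q x q + rankOneT c q y x q + rankOneT c q q x y +
  rankOneT c y q q x + rankOneT c q y q x + rankOneT c q q y x

lemma frob_insertTwo_le {n : ℕ} {c : ℝ} {x y q : Fin n → ℝ}
    (hx : l2Sq x ≤ 1) (hy : l2Sq y ≤ 1) (hq : l2Sq q ≤ 1) :
    frob (insertTwo c x y q) ≤ 12 * |c| := by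
  unfold insertTwo
  have key (p q : T4 n) (m : ℝ) (hp : frob p ≤ m * |c|) (hq : frob q ≤ |c|) :
      frob (p + q) ≤ (m + 1) * |c| := by
    linarith [frob_add_le p q]
  have h12 : (12 : ℝ) = 1 + 1 + 1 + 1 + 1 + 1 + 1 + 1 + 1 + 1 + 1 + 1 := by norm_num
  rw [h12]
  iterate 11
    refine key _ _ _ ?_ (frob_rankOneT_le (by assumption) (by assumption) (by assumption)
      (by assumption))
  rw [one_mul]
  exact frob_rankOneT_le hx hy hq hq

lemma fderiv_Fmap_dirQ {n : ℕ} (w : (Fin n → Fin n → ℝ) × (Fin n → ℝ)) (i j : Fin n) :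
    fderiv ℝ Fmap w (dirQ i j) = insertOne (w.2 j) (Pi.single i 1) (fun a => w.1 a j) := by
  refine fderiv_T4_eq (differentiable_Fmap w) fun a b r s => ?_
  simp only [Fmap_apply, Prod.fst_add, Prod.snd_add, Prod.smul_fst, Prod.smul_snd, Pi.add_apply,
    Pi.smul_apply, smul_eq_mul]
  have h (a p : Fin n) := hasDerivAt_add_mul (w.1 a p) ((dirQ i j).1 a p)
  have hd (p : Fin n) := hasDerivAt_add_mul (w.2 p) ((dirQ i j).2 p)
  refine (HasDerivAt.fun_sum fun p _ =>
    ((((hd p).fun_mul (h a p)).fun_mul (h b p)).fun_mul (h r p)).fun_mul (h s p)).congr_deriv ?_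
  rw [Finset.sum_eq_single j]
  · have h₁ (a : Fin n) : (dirQ i j).1 a j = (Pi.single i 1 : Fin n → ℝ) a := by
      simp [dirQ, Pi.single_apply]
    have h₂ : (dirQ i j).2 j = 0 := rfl
    simp only [h₁, h₂, insertOne, rankOneT, Pi.add_apply]
    ring
  · intro p _ hp
    simp [dirQ, hp]
  · simp

lemma fderiv_fderiv_Fmap_dirQ {n : ℕ} (u : (Fin n → Fin n → ℝ) × (Fin n → ℝ))
    (i j k l : Fin n) :
    fderiv ℝ (fun w => fderiv ℝ Fmap w (dirQ i j)) u (dirQ k l) =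
      insertTwo (u.2 j) (Pi.single i 1) (fun a => (dirQ k l).1 a j) (fun a => u.1 a j) := by
  simp only [fderiv_Fmap_dirQ]
  refine fderiv_T4_eq ?_ fun a b r s => ?_
  · refine differentiableAt_pi.2 fun a => differentiableAt_pi.2 fun b =>
      differentiableAt_pi.2 fun r => differentiableAt_pi.2 fun s => ?_
    simp only [insertOne, rankOneT, Pi.add_apply]
    fun_prop
  · simp only [insertOne, rankOneT, Prod.fst_add, Prod.snd_add, Prod.smul_fst, Prod.smul_snd,
      Pi.add_apply, Pi.smul_apply, smul_eq_mul]
    have h (a : Fin n) := hasDerivAt_add_mul (u.1 a j) ((dirQ k l).1 a j)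
    have hd := hasDerivAt_add_mul (u.2 j) ((dirQ k l).2 j)
    have e (a : Fin n) := hasDerivAt_const (0 : ℝ) ((Pi.single i 1 : Fin n → ℝ) a)
    have m {y₁ y₂ y₃ y₄ : ℝ → ℝ} {z₁ z₂ z₃ z₄ : ℝ} (h₁ : HasDerivAt y₁ z₁ 0)
        (h₂ : HasDerivAt y₂ z₂ 0) (h₃ : HasDerivAt y₃ z₃ 0) (h₄ : HasDerivAt y₄ z₄ 0) :=
      (((hd.fun_mul h₁).fun_mul h₂).fun_mul h₃).fun_mul h₄
    refine ((((m (e a) (h b) (h r) (h s)).fun_add (m (h a) (e b) (h r) (h s))).fun_add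
      (m (h a) (h b) (e r) (h s))).fun_add (m (h a) (h b) (h r) (e s))).congr_deriv ?_
    have h₂ : (dirQ k l).2 j = 0 := rfl
    simp only [h₂, insertTwo, rankOneT, Pi.add_apply]
    ring

lemma l2Sq_col_le_one {n : ℕ} {A : Matrix (Fin n) (Fin n) ℝ} (hA : specNorm A ≤ 1) (j : Fin n) :
    l2Sq (fun a => A a j) ≤ 1 := by
  have h := (Matrix.toEuclideanCLM (𝕜 := ℝ) A).le_of_opNorm_le hA (EuclideanSpace.single j 1)
  rw [EuclideanSpace.norm_eq] at h
  simpa [l2Sq] using h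

lemma l2Sq_single {n : ℕ} (i : Fin n) : l2Sq (Pi.single i 1 : Fin n → ℝ) = 1 := by
  simp [l2Sq, Pi.single_apply]

lemma l2Sq_dirQ_col_le_one {n : ℕ} (j k l : Fin n) :
    l2Sq (fun a => (dirQ k l).1 a j) ≤ 1 := by
  by_cases h : j = l <;> simp [l2Sq, dirQ, h]

lemma abs_le_frob {n : ℕ} (S : T4 n) (a b r s : Fin n) : |S a b r s| ≤ frob S := by
  refine Real.abs_le_sqrt ?_
  have h := Finset.single_le_sum (f := fun x => tvec S x ^ 2) (fun x _ => sq_nonneg _)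
    (Finset.mem_univ (a, b, r, s))
  simpa [frobSq, tvec, Fintype.sum_prod_type] using h

/-- second partial derivatives of f(Q,S) = vec(S ×₁Q ×₂Q ×₃Q ×₄Q)
with respect to two entries of Q are bounded: if ‖Q‖₂ ≤ 1 and ‖S‖_F ≤ R then
‖∂²f/∂Q_{ij}∂Q_{kℓ}‖₂ ≤ 12R. -/
theorem second_partial_QQ_bound (n : ℕ) (R : ℝ)
    (u : (Fin n → Fin n → ℝ) × (Fin n → ℝ))
    (hQ : specNorm (Matrix.of u.1) ≤ 1) (hS : frob (diagT u.2) ≤ R)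
    (i j k l : Fin n) :
    frob (fderiv ℝ (fun w => fderiv ℝ Fmap w (dirQ i j)) u (dirQ k l)) ≤ 12 * R := by
  have hd : |u.2 j| ≤ R := by
    simpa [diagT] using (abs_le_frob (diagT u.2) j j j j).trans hS
  rw [fderiv_fderiv_Fmap_dirQ]
  calc _ ≤ 12 * |u.2 j| := frob_insertTwo_le (l2Sq_single i).le (l2Sq_dirQ_col_le_one j k l)
        (l2Sq_col_le_one hQ j)
    _ ≤ 12 * R := by gcongr
end
end

section
/- Let f : U → V be a differentiable map between finite-dimensional Euclidean spaces, with derivative Df_u at u, and suppose there exist constants C₁, C₂, C₃ > 0 and ε₀ > 0 such that: (1) ‖f(u) − f(u') − Df_{u'}ᵀ(u − u')‖ ≤ C₁‖u − u'‖² for all u, u' with ‖u − u'‖ ≤ 2ε₀ (Taylor approximation); (2) ‖Df_u − Df_{u'}‖ ≤ C₂‖u − u'‖ (bounded curvature); (3) ‖f(u) − f(u')‖ ≥ (1/C₃)‖u − u'‖ (bounded inverse gradient / co-Lipschitz property). Then for every base point u_i and all u, u' in the ball of radius ε₀ around u_i with f(u) ≠ f(u'), setting Z = f(u) and Z' = f(u'),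 ‖ (Z − Z')/‖Z − Z'‖ − Df_{u_i}ᵀ(u − u')/‖Z − Z'‖ ‖ ≤ C₃(2C₁ + C₂)·ε₀. -/
/-- Short secants approximated by tangent vectors, Lemma A.5.
If f has C₁-bounded Taylor error, C₂-Lipschitz derivative and co-Lipschitz
constant 1/C₃, then for u, u' in the ball of radius ε₀ around uᵢ with
f(u) ≠ f(u'), the normalized secant is within C₃(2C₁+C₂)ε₀ of the corresponding
normalized tangent vector. -/
theorem short_secant_tangent_approx
    {U V : Type*} [NormedAddCommGroup U] [InnerProductSpace ℝ U]
    [FiniteDimensional ℝ U] [NormedAddCommGroup V] [InnerProductSpace ℝ V]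
    [FiniteDimensional ℝ V]
    (f : U → V) (hf : Differentiable ℝ f)
    (C₁ C₂ C₃ ε₀ : ℝ) (hC₁ : 0 < C₁) (hC₂ : 0 < C₂) (hC₃ : 0 < C₃) (hε₀ : 0 < ε₀)
    -- (1) Taylor approximation
    (h1 : ∀ u u' : U, ‖u - u'‖ ≤ 2 * ε₀ →
      ‖f u - f u' - fderiv ℝ f u' (u - u')‖ ≤ C₁ * ‖u - u'‖ ^ 2)
    -- (2) bounded curvature
    (h2 : ∀ u u' : U, ‖fderiv ℝ f u - fderiv ℝ f u'‖ ≤ C₂ * ‖u - u'‖)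
    -- (3) bounded inverse gradient (co-Lipschitz)
    (h3 : ∀ u u' : U, (1 / C₃) * ‖u - u'‖ ≤ ‖f u - f u'‖)
    (ui u u' : U) (hu : ‖u - ui‖ ≤ ε₀) (hu' : ‖u' - ui‖ ≤ ε₀)
    (hne : f u ≠ f u') :
    ‖(‖f u - f u'‖)⁻¹ • (f u - f u')
        - (‖f u - f u'‖)⁻¹ • (fderiv ℝ f ui (u - u'))‖ ≤
      C₃ * (2 * C₁ + C₂) * ε₀ := by
  have hr : 0 < ‖f u - f u'‖ := norm_pos_iff.mpr (sub_ne_zero.mpr hne)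
  have hd : ‖u - u'‖ ≤ 2 * ε₀ := by
    have := norm_sub_le_norm_sub_add_norm_sub u ui u'
    rw [norm_sub_rev ui u'] at this
    linarith
  have hsecant : ‖u - u'‖ ≤ C₃ * ‖f u - f u'‖ := by
    have := h3 u u'
    rwa [one_div, inv_mul_le_iff₀ hC₃] at this
  have hcurv : ‖(fderiv ℝ f u' - fderiv ℝ f ui) (u - u')‖ ≤ C₂ * ε₀ * ‖u - u'‖ :=
    ContinuousLinearMap.le_of_opNorm_le _ ((h2 u' ui).trans (by gcongr)) _
  have hsplit : f u - f u' - fderiv ℝ f ui (u - u') =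
      (f u - f u' - fderiv ℝ f u' (u - u')) + (fderiv ℝ f u' - fderiv ℝ f ui) (u - u') := by
    rw [sub_apply]
    abel
  rw [← smul_sub, norm_smul, norm_inv, norm_norm, inv_mul_le_iff₀ hr]
  calc ‖f u - f u' - fderiv ℝ f ui (u - u')‖
      ≤ C₁ * ‖u - u'‖ ^ 2 + C₂ * ε₀ * ‖u - u'‖ := by
        rw [hsplit]
        exact norm_add_le_of_le (h1 u u' hd) hcurv
    _ = (C₁ * ‖u - u'‖ + C₂ * ε₀) * ‖u - u'‖ := by ring
    _ ≤ (C₁ * (2 * ε₀) + C₂ * ε₀) * (C₃ * ‖f u - f u'‖) := by gcongr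
    _ = ‖f u - f u'‖ * (C₃ * (2 * C₁ + C₂) * ε₀) := by ring
end

section
/- Let M be a subset of a finite-dimensional Euclidean space and let γ > 0, ε ∈ (0,1). Suppose N̲ ⊆ M is an (εγ)-net for M (every point of M is within distance εγ of some point of N̲). Define the set of long normalized secants 𝔑_{4γ}(M − M) = { (z₁ − z₂)/‖z₁ − z₂‖ : z₁, z₂ ∈ M, ‖z₁ − z₂‖ > 4γ }. Then the set of normalized differences of elements of N̲, 𝔑(N̲ − N̲) = { (w₁ − w₂)/‖w₁ − w₂‖ : w₁ ≠ w₂ ∈ N̲ }, is an ε-cover for 𝔑_{4γ}(M − M): every long normalized secant of M is within distance ε of a normalized difference of net points. In particular, CN(𝔑_{4γ}(M − M), ε) ≤ CN(M, εγ)². -/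
/-- Normalization is Lipschitz with constant `2 / ‖a‖` at a nonzero vector `a`. -/
theorem norm_normalize_sub_normalize_le {E : Type*} [NormedAddCommGroup E] [NormedSpace ℝ E]
    {a b : E} (ha : a ≠ 0) (hb : b ≠ 0) :
    ‖‖a‖⁻¹ • a - ‖b‖⁻¹ • b‖ ≤ 2 * ‖a - b‖ / ‖a‖ := by
  have ha' : 0 < ‖a‖ := norm_pos_iff.mpr ha
  have hb' : 0 < ‖b‖ := norm_pos_iff.mpr hb
  have hsplit : ‖a‖⁻¹ • a - ‖b‖⁻¹ • b =
      ‖a‖⁻¹ • ((a - b) + ((‖b‖ - ‖a‖) * ‖b‖⁻¹) • b) := by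
    have hcoeff : ‖a‖⁻¹ * ((‖b‖ - ‖a‖) * ‖b‖⁻¹) = ‖a‖⁻¹ - ‖b‖⁻¹ := by
      field_simp
    rw [smul_add, smul_smul, hcoeff, smul_sub, sub_smul]
    abel
  have hdiff : ‖((‖b‖ - ‖a‖) * ‖b‖⁻¹) • b‖ ≤ ‖a - b‖ := by
    rw [norm_smul, norm_mul, norm_inv, norm_norm, mul_assoc, inv_mul_cancel₀ hb'.ne', mul_one,
      Real.norm_eq_abs, norm_sub_rev a b]
    exact abs_norm_sub_norm_le b a
  rw [hsplit, norm_smul, norm_inv, norm_norm, inv_mul_eq_div]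
  gcongr
  linarith [norm_add_le (a - b) (((‖b‖ - ‖a‖) * ‖b‖⁻¹) • b)]

/-- Long secants covering, Lemma A.6 / Clarkson Lemma 4.1.
If N̲ ⊆ M is an (εγ)-net for M, then the normalized differences of distinct net
points form an ε-cover of the set of long normalized secants
{(z₁−z₂)/‖z₁−z₂‖ : z₁, z₂ ∈ M, ‖z₁−z₂‖ > 4γ}; in particular the long normalized
secants admit an ε-cover of cardinality at most |N̲|². -/
theorem long_secants_cover
    {E : Type*} [NormedAddCommGroup E] [InnerProductSpace ℝ E]
    [FiniteDimensional ℝ E]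
    (M : Set E) (γ ε : ℝ) (hγ : 0 < γ) (hε : ε ∈ Set.Ioo (0 : ℝ) 1)
    (Nnet : Finset E) (hsub : (↑Nnet : Set E) ⊆ M)
    (hnet : ∀ z ∈ M, ∃ w ∈ Nnet, ‖z - w‖ ≤ ε * γ) :
    (∀ z₁ ∈ M, ∀ z₂ ∈ M, 4 * γ < ‖z₁ - z₂‖ →
        ∃ w₁ ∈ Nnet, ∃ w₂ ∈ Nnet, w₁ ≠ w₂ ∧
          ‖(‖z₁ - z₂‖)⁻¹ • (z₁ - z₂) - (‖w₁ - w₂‖)⁻¹ • (w₁ - w₂)‖ ≤ ε) ∧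
      ∃ C : Finset E, C.card ≤ Nnet.card ^ 2 ∧
        ∀ z₁ ∈ M, ∀ z₂ ∈ M, 4 * γ < ‖z₁ - z₂‖ →
          ∃ c ∈ C, ‖(‖z₁ - z₂‖)⁻¹ • (z₁ - z₂) - c‖ ≤ ε := by
  have hcover : ∀ z₁ ∈ M, ∀ z₂ ∈ M, 4 * γ < ‖z₁ - z₂‖ →
      ∃ w₁ ∈ Nnet, ∃ w₂ ∈ Nnet, w₁ ≠ w₂ ∧
        ‖(‖z₁ - z₂‖)⁻¹ • (z₁ - z₂) - (‖w₁ - w₂‖)⁻¹ • (w₁ - w₂)‖ ≤ ε := by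
    intro z₁ hz₁ z₂ hz₂ hlong
    obtain ⟨w₁, hw₁, h₁⟩ := hnet z₁ hz₁
    obtain ⟨w₂, hw₂, h₂⟩ := hnet z₂ hz₂
    have hεγ : ε * γ < γ := mul_lt_of_lt_one_left hγ hε.2
    have hpos : 0 < ‖z₁ - z₂‖ := by linarith
    have hclose : ‖(z₁ - z₂) - (w₁ - w₂)‖ ≤ 2 * (ε * γ) := by
      rw [sub_sub_sub_comm]
      linarith [norm_sub_le (z₁ - w₁) (z₂ - w₂)]
    have hne : w₁ ≠ w₂ := by
      rintro rfl
      rw [sub_self, sub_zero] at hclose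
      linarith
    refine ⟨w₁, hw₁, w₂, hw₂, hne,
      (norm_normalize_sub_normalize_le (norm_pos_iff.mp hpos) (sub_ne_zero.mpr hne)).trans ?_⟩
    rw [div_le_iff₀ hpos]
    linarith [mul_lt_mul_of_pos_left hlong hε.1]
  classical
  refine ⟨hcover, (Nnet ×ˢ Nnet).image fun p => ‖p.1 - p.2‖⁻¹ • (p.1 - p.2), ?_, ?_⟩
  · exact Finset.card_image_le.trans (by rw [Finset.card_product, sq])
  · intro z₁ hz₁ z₂ hz₂ hlong
    obtain ⟨w₁, hw₁, w₂, hw₂, -, h⟩ := hcover z₁ hz₁ z₂ hz₂ hlong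
    exact ⟨_, Finset.mem_image_of_mem _ (Finset.mk_mem_product hw₁ hw₂), h⟩
end
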